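/- Let m and d be natural numbers with 1 ≤ d and d + 1 ≤ m, and set a = m − d − 1. In ℝ^m, with one distinguished coordinate λ, a coordinates indexed by T, and d coordinates indexed by Y, let S be the finite set consisting of: the origin 0, the standard basis vector e_λ, the vectors e_i for i ∈ T, the vectors e_i + e_j for all i, j ∈ T (including i = j), the vectors e_l for l ∈ Y, and the vectors e_l + e_i for l ∈ Y and i ∈ T. Then m! times the Lebesgue measure of the convex hull of S in ℝ^m equals Σ_{k=0}^{m−d−1} 2^k · C(m−k−2, d−1). -/

import Mathlib

open MeasureTheory
open scoped ENNReal

lemma volume_eq_lintegral_insertNth {n : ℕ} (i : Fin (n + 1)) {A : Set (Fin (n + 1) → ℝ)}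
    (hA : MeasurableSet A) :
    volume A = ∫⁻ t, volume {x : Fin n → ℝ | i.insertNth t x ∈ A} := by
  have h := (volume_preserving_piFinSuccAbove (fun _ : Fin (n + 1) => ℝ) i).symm
  rw [← h.measure_preimage hA.nullMeasurableSet, Measure.volume_eq_prod,
    Measure.prod_apply (h.measurable hA)]
  rfl

/-- Volume by slicing along a coordinate, when the slices at heights in `[0, p]` have volume
`g (p - t)` and all other slices are empty. -/
lemma volume_eq_of_slices {n : ℕ} (i : Fin (n + 1)) {A : Set (Fin (n + 1) → ℝ)}
    (hA : MeasurableSet A) {p : ℝ} (hp : 0 ≤ p) {g : ℝ → ℝ} (hg : Continuous g)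
    (hg0 : ∀ s, 0 ≤ s → 0 ≤ g s) (hsub : ∀ x ∈ A, x i ∈ Set.Icc 0 p)
    (hslice : ∀ t ∈ Set.Icc 0 p,
      volume {x : Fin n → ℝ | i.insertNth t x ∈ A} = ENNReal.ofReal (g (p - t))) :
    volume A = ENNReal.ofReal (∫ s in (0 : ℝ)..p, g s) := by
  have h1 : (fun t => volume {x : Fin n → ℝ | i.insertNth t x ∈ A}) =
      (Set.Icc 0 p).indicator fun t => ENNReal.ofReal (g (p - t)) := by
    funext t
    by_cases ht : t ∈ Set.Icc 0 p
    · rw [Set.indicator_of_mem ht, hslice t ht]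
    · rw [Set.indicator_of_notMem ht]
      have : {x : Fin n → ℝ | i.insertNth t x ∈ A} = ∅ := by
        ext x
        simp only [Set.mem_ofPred_eq, Set.mem_empty_iff_false, iff_false]
        intro hx
        exact ht (by simpa using hsub _ hx)
      simp [this]
  have hc : Continuous fun t => g (p - t) := by fun_prop
  rw [volume_eq_lintegral_insertNth i hA, h1, lintegral_indicator measurableSet_Icc,
    ← ofReal_integral_eq_lintegral_ofReal (hc.integrableOn_Icc)
      ((ae_restrict_iff' measurableSet_Icc).2 <| .of_forall fun t ht =>
        hg0 _ (sub_nonneg.2 ht.2)),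
    integral_Icc_eq_integral_Ioc, ← intervalIntegral.integral_of_le hp,
    intervalIntegral.integral_comp_sub_left]
  simp

lemma volume_simplex (n : ℕ) {q : ℝ} (hq : 0 ≤ q) :
    volume {x : Fin n → ℝ | 0 ≤ x ∧ ∑ i, x i ≤ q} = ENNReal.ofReal (q ^ n / n.factorial) := by
  induction n generalizing q with
  | zero =>
    have : {x : Fin 0 → ℝ | 0 ≤ x ∧ ∑ i, x i ≤ q} = Set.univ := by
      ext x
      simp [hq, Subsingleton.elim x 0]
    rw [this]
    simp [volume_pi]
  | succ n ih =>
    rw [volume_eq_of_slices (p := q) (g := fun s => s ^ n / n.factorial) 0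
      (by measurability) hq (by fun_prop) (fun s hs => by positivity)]
    · congr 1
      rw [intervalIntegral.integral_div, integral_pow, Nat.factorial_succ]
      push_cast
      field_simp
      simp
    · rintro x ⟨h0, h⟩
      exact ⟨h0 0, (Finset.single_le_sum (fun i _ => h0 i) (Finset.mem_univ 0)).trans h⟩
    · rintro t ⟨ht0, htq⟩
      rw [← ih (sub_nonneg.2 htq)]
      congr 1
      ext x
      simp only [Set.mem_ofPred_eq, Fin.insertNth_zero', Fin.sum_cons, Pi.le_def,
        Fin.forall_fin_succ, Fin.cons_zero, Fin.cons_succ, Pi.zero_apply, ht0, true_and,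
        le_sub_iff_add_le']

/-- The section of the pyramid at fixed `λ`: the first `a` coordinates are the `t_i`, the last `d`
coordinates are the `y_l`. -/
def pyramidSection (a d : ℕ) (p r : ℝ) : Set (Fin (a + d) → ℝ) :=
  {x | 0 ≤ x ∧ ∑ i : Fin (a + d), (if a ≤ (i : ℕ) then x i else 0) ≤ p ∧ ∑ i, x i ≤ p + r}

lemma mem_pyramidSection (a d : ℕ) {p r : ℝ} {x : Fin (a + d) → ℝ} :
    x ∈ pyramidSection a d p r ↔ 0 ≤ x ∧
      ∑ i : Fin (a + d), (if a ≤ (i : ℕ) then x i else 0) ≤ p ∧ ∑ i, x i ≤ p + r :=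
  Iff.rfl

lemma isClosed_pyramidSection (a d : ℕ) (p r : ℝ) : IsClosed (pyramidSection a d p r) := by
  refine (isClosed_le continuous_const continuous_id).and
    ((isClosed_le ?_ continuous_const).and (isClosed_le ?_ continuous_const))
  · refine continuous_finsetSum _ fun i _ => ?_
    split_ifs <;> fun_prop
  · fun_prop

lemma volume_pyramidSection (a d : ℕ) {p r : ℝ} (hp : 0 ≤ p) (hr : 0 ≤ r) :
    volume (pyramidSection a d p r) = ENNReal.ofReal (∑ i ∈ Finset.range (a + 1),
      p ^ (i + d) / (i + d).factorial * (r ^ (a - i) / (a - i).factorial)) := by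
  induction d generalizing p with
  | zero =>
    have : pyramidSection a 0 p r = {x : Fin a → ℝ | 0 ≤ x ∧ ∑ i, x i ≤ p + r} := by
      ext x
      have : ∑ i : Fin (a + 0), (if a ≤ (i : ℕ) then x i else 0) = 0 :=
        Finset.sum_eq_zero fun i _ => if_neg (by have := i.2; omega)
      simp only [pyramidSection, Set.mem_ofPred_eq, this, hp, true_and]
      rfl
    rw [this, volume_simplex a (add_nonneg hp hr), add_pow, Finset.sum_div]
    congr 1
    refine Finset.sum_congr rfl fun i hi => ?_
    rw [Nat.cast_choose ℝ (Finset.mem_range_succ_iff.1 hi)]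
    simp only [add_zero]
    field_simp
  | succ d ih =>
    rw [volume_eq_of_slices (n := a + d) (p := p) (g := fun s => ∑ i ∈ Finset.range (a + 1),
        s ^ (i + d) / (i + d).factorial * (r ^ (a - i) / (a - i).factorial)) (Fin.last _)
      (isClosed_pyramidSection a (d + 1) p r).measurableSet hp (by fun_prop)
      (fun s hs => by positivity)]
    · congr 1
      rw [intervalIntegral.integral_finsetSum
        (fun i _ => (by fun_prop : Continuous _).intervalIntegrable _ _)]
      refine Finset.sum_congr rfl fun i _ => ?_
      rw [intervalIntegral.integral_mul_const, intervalIntegral.integral_div, integral_pow,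
        ← add_assoc, Nat.factorial_succ]
      push_cast
      field_simp
      simp
    · rintro x ⟨h0, h, -⟩
      refine ⟨h0 _, le_trans ?_ h⟩
      have := Finset.single_le_sum (f := fun i : Fin (a + (d + 1)) =>
        if a ≤ (i : ℕ) then x i else 0) (fun i _ => by split_ifs; exacts [h0 i, le_rfl])
        (Finset.mem_univ (Fin.last (a + d)))
      simpa using this
    · rintro t ⟨ht0, htp⟩
      rw [← ih (sub_nonneg.2 htp)]
      congr 1
      ext x
      have h0 : (0 : Fin (a + (d + 1)) → ℝ) ≤ (Fin.last (a + d)).insertNth (α := fun _ => ℝ) t x ↔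
          0 ≤ x := by
        rw [Fin.insertNth_last', Pi.le_def, Pi.le_def]
        refine (Fin.forall_fin_succ' (n := a + d)).trans ?_
        simp [ht0]
      refine Iff.trans (mem_pyramidSection a (d + 1)) (Iff.trans ?_ (mem_pyramidSection a d).symm)
      have hs : ∀ f : Fin (a + (d + 1)) → ℝ, ∑ i, f i =
          ∑ i : Fin (a + d), f (Fin.castSucc i) + f (Fin.last (a + d)) :=
        Fin.sum_univ_castSucc (n := a + d)
      rw [h0, Fin.insertNth_last', hs, hs]
      simp only [Fin.snoc_castSucc, Fin.snoc_last, Fin.val_castSucc, Fin.val_last,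
        le_add_iff_nonneg_right, zero_le, if_true]
      refine and_congr_right fun _ => and_congr ?_ ?_ <;> constructor <;> intro h <;> linarith

/-- The inequality description of the Newton polytope, in the coordinates `λ, t, y`. -/
def newtonPolytope (a d : ℕ) : Set (Fin (a + d + 1) → ℝ) :=
  {x | 0 ≤ x ∧ x 0 + ∑ i : Fin (a + d), (if a ≤ (i : ℕ) then x i.succ else 0) ≤ 1 ∧
    2 * x 0 + ∑ i : Fin (a + d), x i.succ ≤ 2}

lemma isClosed_newtonPolytope (a d : ℕ) : IsClosed (newtonPolytope a d) := by
  refine (isClosed_le continuous_const continuous_id).and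
    ((isClosed_le ?_ continuous_const).and (isClosed_le ?_ continuous_const))
  · refine (continuous_apply _).add (continuous_finsetSum _ fun i _ => ?_)
    split_ifs <;> fun_prop
  · fun_prop

lemma volume_newtonPolytope (a d : ℕ) :
    ((a + d + 1).factorial : ℝ≥0∞) * volume (newtonPolytope a d) =
      ((∑ i ∈ Finset.range (a + 1), (a + d).choose i : ℕ) : ℝ≥0∞) := by
  have key : volume (newtonPolytope a d) = ENNReal.ofReal
      (∫ s in (0 : ℝ)..1, ∑ i ∈ Finset.range (a + 1),
        s ^ (i + d) / (i + d).factorial * (s ^ (a - i) / (a - i).factorial)) := by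
    refine volume_eq_of_slices 0 (isClosed_newtonPolytope a d).measurableSet zero_le_one
      (by fun_prop) (fun s hs => by positivity) ?_ ?_
    · rintro x ⟨h0, h, -⟩
      refine ⟨h0 0, le_trans (le_add_of_nonneg_right ?_) h⟩
      exact Finset.sum_nonneg fun i _ => by split_ifs; exacts [h0 _, le_rfl]
    · rintro t ⟨ht0, ht1⟩
      rw [← volume_pyramidSection a d (sub_nonneg.2 ht1) (sub_nonneg.2 ht1)]
      congr 1
      ext x
      simp only [newtonPolytope, pyramidSection, Set.mem_ofPred_eq, Fin.insertNth_zero', Pi.le_def,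
        Fin.forall_fin_succ, Fin.cons_zero, Fin.cons_succ, Pi.zero_apply, ht0, true_and]
      refine and_congr_right fun _ => and_congr ?_ ?_ <;> constructor <;> intro h <;> linarith
  have hint : ∫ s in (0 : ℝ)..1, ∑ i ∈ Finset.range (a + 1),
        s ^ (i + d) / (i + d).factorial * (s ^ (a - i) / (a - i).factorial) =
      (∑ i ∈ Finset.range (a + 1), ((a + d).choose i : ℝ)) / (a + d + 1).factorial := by
    rw [intervalIntegral.integral_finsetSum
        (fun i _ => (by fun_prop : Continuous _).intervalIntegrable _ _), Finset.sum_div,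
      ← Finset.sum_range_reflect]
    refine Finset.sum_congr rfl fun i hi => ?_
    have hi : i ≤ a := Finset.mem_range_succ_iff.1 hi
    have h1 : a + 1 - 1 - i + d = a + d - i := by omega
    have h2 : a - (a + 1 - 1 - i) = i := by omega
    have h3 : ∀ s : ℝ, s ^ (a + d - i) / (a + d - i).factorial * (s ^ i / i.factorial) =
        s ^ (a + d) / ((a + d - i).factorial * i.factorial) := fun s => by
      rw [div_mul_div_comm, ← pow_add, Nat.sub_add_cancel (by omega)]
    simp only [h1, h2, h3]
    rw [intervalIntegral.integral_div, integral_pow, Nat.cast_choose ℝ (by omega : i ≤ a + d),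
      Nat.factorial_succ]
    push_cast
    field_simp
    simp
  rw [key, hint, ← ENNReal.ofReal_natCast (a + d + 1).factorial,
    ← ENNReal.ofReal_mul (by positivity), mul_div_cancel₀ _ (by positivity),
    ← Nat.cast_sum, ENNReal.ofReal_natCast]

lemma sum_range_choose_eq_sum_two_pow_mul_choose (a e : ℕ) :
    ∑ i ∈ Finset.range (a + 1), (a + e + 1).choose i =
      ∑ k ∈ Finset.range (a + 1), 2 ^ k * (a + e - k).choose e := by
  induction a with
  | zero => simp
  | succ a ih =>
    have h1 : ∑ i ∈ Finset.range (a + 1 + 1), (a + 1 + e + 1).choose i =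
        (a + 1 + e).choose (a + 1) + 2 * ∑ i ∈ Finset.range (a + 1), (a + e + 1).choose i := by
      rw [Finset.sum_range_succ', Finset.sum_congr rfl fun i _ => Nat.choose_succ_succ _ i,
        Finset.sum_add_distrib, show a + 1 + e = a + e + 1 by omega]
      have := Finset.sum_range_succ' (fun i => (a + e + 1).choose i) (a + 1)
      rw [Finset.sum_range_succ] at this
      simp only [Nat.choose_zero_right, Nat.succ_eq_add_one] at this ⊢
      omega
    rw [h1, ih, Finset.sum_range_succ' _ (a + 1), Finset.mul_sum, add_comm,
      show (a + 1 + e).choose (a + 1) = (a + 1 + e).choose e from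
        Nat.choose_symm_of_eq_add rfl]
    congr 1
    · refine Finset.sum_congr rfl fun k _ => ?_
      rw [pow_succ, show a + 1 + e - (k + 1) = a + e - k by omega]
      ring
    · simp

lemma Convex.one_sub_sum_smul_add_sum_mem {E ι : Type*} [AddCommGroup E] [Module ℝ E] [Fintype ι]
    {s : Set E} (hs : Convex ℝ s) {b : E} (hb : b ∈ s) {w : ι → ℝ} {z : ι → E}
    (hw : ∀ i, 0 ≤ w i) (hw1 : ∑ i, w i ≤ 1) (hz : ∀ i, z i ∈ s) :
    (1 - ∑ i, w i) • b + ∑ i, w i • z i ∈ s := by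
  have := hs.sum_mem (t := Finset.univ) (w := fun o : Option ι => o.elim (1 - ∑ i, w i) w)
    (z := fun o => o.elim b z) (by rintro (_ | i) - <;> simp [hw, hw1])
    (by simp [Fintype.sum_option]) (by rintro (_ | i) - <;> simp [hb, hz])
  simpa [Fintype.sum_option] using this

lemma convex_newtonPolytope (a d : ℕ) : Convex ℝ (newtonPolytope a d) := by
  rintro x ⟨hx0, hx1, hx2⟩ y ⟨hy0, hy1, hy2⟩ u v hu hv huv
  have h1 : ∀ i : Fin (a + d), (if a ≤ (i : ℕ) then (u • x + v • y) i.succ else 0) =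
      u * (if a ≤ (i : ℕ) then x i.succ else 0) + v * (if a ≤ (i : ℕ) then y i.succ else 0) :=
    fun i => by split_ifs <;> simp
  refine ⟨add_nonneg (smul_nonneg hu hx0) (smul_nonneg hv hy0), ?_, ?_⟩
  · simp only [h1, Finset.sum_add_distrib, ← Finset.mul_sum]
    simp only [Pi.add_apply, Pi.smul_apply, smul_eq_mul]
    nlinarith [mul_le_mul_of_nonneg_left hx1 hu, mul_le_mul_of_nonneg_left hy1 hv]
  · simp only [Pi.add_apply, Pi.smul_apply, smul_eq_mul, Finset.sum_add_distrib, ← Finset.mul_sum]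
    nlinarith [mul_le_mul_of_nonneg_left hx2 hu, mul_le_mul_of_nonneg_left hy2 hv]

/-- The vertices `0` and `e_i` of the simplex in the `t`-coordinates. -/
def tSimplexVertices (a d : ℕ) : Set (Fin (a + d + 1) → ℝ) :=
  insert 0 {v | ∃ i : Fin (a + d), (i : ℕ) < a ∧ v = Pi.single i.succ 1}

lemma newtonPolytope_subset_convexHull {a d : ℕ} {S : Set (Fin (a + d + 1) → ℝ)}
    (hlam : Pi.single 0 1 ∈ S)
    (htt : ∀ u ∈ tSimplexVertices a d, ∀ v ∈ tSimplexVertices a d, u + v ∈ S)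
    (hyt : ∀ l : Fin (a + d), a ≤ (l : ℕ) → ∀ v ∈ tSimplexVertices a d,
      Pi.single l.succ 1 + v ∈ S) :
    newtonPolytope a d ⊆ convexHull ℝ S := by
  rintro x ⟨h0, h1, h2⟩
  set Y := ∑ i : Fin (a + d), (if a ≤ (i : ℕ) then x i.succ else 0) with hY
  set T := ∑ i : Fin (a + d), (if a ≤ (i : ℕ) then 0 else x i.succ) with hT
  have hYT : ∑ i : Fin (a + d), x i.succ = Y + T := by
    rw [hY, hT, ← Finset.sum_add_distrib]
    exact Finset.sum_congr rfl fun i _ => by split_ifs <;> simp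
  have hT0 : ∀ i : Fin (a + d), 0 ≤ if a ≤ (i : ℕ) then 0 else x i.succ :=
    fun i => by split_ifs; exacts [le_rfl, h0 _]
  have hTnn : 0 ≤ T := Finset.sum_nonneg fun i _ => hT0 i
  set q := 2 - 2 * x 0 - Y with hq
  have hTq : T ≤ q := by linarith
  have hqT : ∀ i : Fin (a + d), q * ((if a ≤ (i : ℕ) then 0 else x i.succ) / q) =
      if a ≤ (i : ℕ) then 0 else x i.succ := fun i => by
    refine mul_div_cancel_of_imp' fun hq0 => ?_
    have := Finset.single_le_sum (fun i _ => hT0 i) (Finset.mem_univ i)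
    exact le_antisymm (by linarith) (hT0 i)
  set σ : Fin (a + d + 1) → ℝ := ∑ i : Fin (a + d),
    ((if a ≤ (i : ℕ) then 0 else x i.succ) / q) • Pi.single i.succ (1 : ℝ) with hσ
  have hσmem : σ ∈ convexHull ℝ (tSimplexVertices a d) := by
    have hz : (0 : Fin (a + d + 1) → ℝ) ∈ convexHull ℝ (tSimplexVertices a d) :=
      subset_convexHull ℝ _ (Set.mem_insert _ _)
    have := (convex_convexHull ℝ (tSimplexVertices a d)).one_sub_sum_smul_add_sum_mem hz
      (w := fun i : Fin (a + d) => (if a ≤ (i : ℕ) then 0 else x i.succ) / q)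
      (z := fun i => if a ≤ (i : ℕ) then 0 else Pi.single i.succ (1 : ℝ))
      (fun i => div_nonneg (hT0 i) (hTnn.trans hTq))
      (by rw [← Finset.sum_div]; exact div_le_one_of_le₀ hTq (hTnn.trans hTq))
      (fun i => by
        split_ifs with hi
        · exact hz
        · exact subset_convexHull ℝ _ (Or.inr ⟨i, not_le.1 hi, rfl⟩))
    convert this using 1
    rw [smul_zero, zero_add]
    exact Finset.sum_congr rfl fun i _ => by split_ifs <;> simp
  have h2σ : σ + σ ∈ convexHull ℝ S := by
    refine convexHull_mono ?_ ((convexHull_add (R := ℝ)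
      (tSimplexVertices a d) (tSimplexVertices a d)).symm ▸ Set.add_mem_add hσmem hσmem)
    rintro _ ⟨u, hu, v, hv, rfl⟩
    exact htt u hu v hv
  have hlσ : ∀ l : Fin (a + d), a ≤ (l : ℕ) → Pi.single l.succ 1 + σ ∈ convexHull ℝ S := by
    intro l hl
    refine convexHull_mono ?_ ((convexHull_add (R := ℝ) {Pi.single l.succ 1}
      (tSimplexVertices a d)).symm ▸
        Set.add_mem_add (subset_convexHull ℝ _ (Set.mem_singleton _)) hσmem)
    rintro _ ⟨u, hu, v, hv, rfl⟩
    rw [Set.mem_singleton_iff.1 hu]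
    exact hyt l hl v hv
  have := (convex_convexHull ℝ S).one_sub_sum_smul_add_sum_mem h2σ
    (w := Fin.cons (x 0) fun i : Fin (a + d) => if a ≤ (i : ℕ) then x i.succ else 0)
    (z := Fin.cons (Pi.single 0 1) fun i : Fin (a + d) =>
      if a ≤ (i : ℕ) then Pi.single i.succ 1 + σ else σ + σ)
    (Fin.cases (h0 0) fun i => by simp only [Fin.cons_succ]; split_ifs; exacts [h0 _, le_rfl])
    (by simpa [Fin.sum_univ_succ] using h1)
    (Fin.cases (subset_convexHull ℝ _ hlam) fun i => by
      simp only [Fin.cons_succ]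
      split_ifs with hi
      exacts [hlσ i hi, h2σ])
  convert this using 1
  have h3 : ∀ i : Fin (a + d), (if a ≤ (i : ℕ) then x i.succ else 0) •
      (if a ≤ (i : ℕ) then Pi.single i.succ (1 : ℝ) + σ else σ + σ) =
      (if a ≤ (i : ℕ) then x i.succ else 0) • (Pi.single i.succ (1 : ℝ) : Fin (a + d + 1) → ℝ) +
      (if a ≤ (i : ℕ) then x i.succ else 0) • σ := fun i => by split_ifs <;> simp
  simp only [Fin.sum_univ_succ, Fin.cons_zero, Fin.cons_succ, h3, Finset.sum_add_distrib,
    ← Finset.sum_smul, ← hY]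
  have h4 : q • σ = ∑ i : Fin (a + d), (if a ≤ (i : ℕ) then 0 else x i.succ) •
      (Pi.single i.succ (1 : ℝ) : Fin (a + d + 1) → ℝ) := by
    simp only [hσ, Finset.smul_sum, smul_smul, hqT]
  have h5 : x = x 0 • (Pi.single 0 (1 : ℝ) : Fin (a + d + 1) → ℝ) +
      ∑ i : Fin (a + d), x i.succ • (Pi.single i.succ (1 : ℝ) : Fin (a + d + 1) → ℝ) := by
    rw [← Fin.sum_univ_succ (fun i => x i • (Pi.single i (1 : ℝ) : Fin (a + d + 1) → ℝ))]
    exact pi_eq_sum_univ' x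
  have h6 : ∑ i : Fin (a + d), x i.succ • (Pi.single i.succ (1 : ℝ) : Fin (a + d + 1) → ℝ) =
      ∑ i : Fin (a + d), (if a ≤ (i : ℕ) then x i.succ else 0) •
        (Pi.single i.succ (1 : ℝ) : Fin (a + d + 1) → ℝ) + q • σ := by
    rw [h4, ← Finset.sum_add_distrib]
    exact Finset.sum_congr rfl fun i _ => by split_ifs <;> simp
  conv_lhs => rw [h5, h6, hq]
  module

lemma single_zero_mem_newtonPolytope (a d : ℕ) : Pi.single 0 1 ∈ newtonPolytope a d := by
  refine ⟨Pi.single_nonneg.2 zero_le_one, ?_, ?_⟩ <;> simp [Fin.succ_ne_zero]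

lemma bounds_of_mem_tSimplexVertices {a d : ℕ} {w : Fin (a + d + 1) → ℝ}
    (hw : w ∈ tSimplexVertices a d) : 0 ≤ w ∧ w 0 = 0 ∧
      (∀ j : Fin (a + d), a ≤ (j : ℕ) → w j.succ = 0) ∧ ∑ j : Fin (a + d), w j.succ ≤ 1 := by
  obtain rfl | ⟨i, hi, rfl⟩ := hw
  · simp
  · refine ⟨Pi.single_nonneg.2 zero_le_one, Pi.single_eq_of_ne (Fin.succ_ne_zero i).symm _,
      fun j hj => Pi.single_eq_of_ne (fun h => ?_) _, ?_⟩
    · rw [Fin.succ_inj.1 h] at hj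
      omega
    · simp [Pi.single_apply]

lemma add_mem_newtonPolytope_of_mem_tSimplexVertices {a d : ℕ} {u v : Fin (a + d + 1) → ℝ}
    (hu : u ∈ tSimplexVertices a d) (hv : v ∈ tSimplexVertices a d) :
    u + v ∈ newtonPolytope a d := by
  obtain ⟨hu0, hu1, hu2, hu3⟩ := bounds_of_mem_tSimplexVertices hu
  obtain ⟨hv0, hv1, hv2, hv3⟩ := bounds_of_mem_tSimplexVertices hv
  refine ⟨add_nonneg hu0 hv0, ?_, ?_⟩
  · rw [Finset.sum_eq_zero fun j _ => ?_]
    · simp [hu1, hv1]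
    · split_ifs with hj
      · simp [hu2 j hj, hv2 j hj]
      · rfl
  · simp only [Pi.add_apply, hu1, hv1, Finset.sum_add_distrib]
    linarith

lemma single_add_mem_newtonPolytope {a d : ℕ} {l : Fin (a + d)} (hl : a ≤ (l : ℕ))
    {v : Fin (a + d + 1) → ℝ} (hv : v ∈ tSimplexVertices a d) :
    Pi.single l.succ 1 + v ∈ newtonPolytope a d := by
  obtain ⟨hv0, hv1, hv2, hv3⟩ := bounds_of_mem_tSimplexVertices hv
  have hl0 : (Pi.single l.succ 1 : Fin (a + d + 1) → ℝ) 0 = 0 :=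
    Pi.single_eq_of_ne (Fin.succ_ne_zero l).symm _
  refine ⟨add_nonneg (Pi.single_nonneg.2 zero_le_one) hv0, ?_, ?_⟩
  · rw [Finset.sum_eq_single l]
    · simp [hl, hv1, hv2 l hl]
    · intro j _ hj
      split_ifs with hj'
      · simp [hv2 j hj', hj]
      · rfl
    · simp
  · simp only [Pi.add_apply, hl0, hv1, Finset.sum_add_distrib]
    have : ∑ j : Fin (a + d), (Pi.single l.succ 1 : Fin (a + d + 1) → ℝ) j.succ = 1 := by
      simp [Pi.single_apply]
    linarith

/-- The combinatorial content of Theorem (QP-volume): with `a = m - d - 1`, the normalized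
volume (i.e. `m!` times the Lebesgue measure) of the convex hull in `ℝ^m` of the exponent
vectors of the monomials `λ, 1, t_i, t_i t_j, y_l, y_l t_i` equals
`∑_{k=0}^{m-d-1} 2^k · C(m-k-2, d-1)`.  Coordinate `0` is the `λ`-coordinate, coordinates
`1, …, a` are the `T`-coordinates and coordinates `a+1, …, m-1` are the `Y`-coordinates. -/
theorem qp_volume_newton_polytope (m d : ℕ) (hd : 1 ≤ d) (hm : d + 1 ≤ m)
    (a : ℕ) (ha : a = m - d - 1) (lam : Fin m) (hlam : (lam : ℕ) = 0)
    (S : Set (Fin m → ℝ))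
    (hS : S = {0, Pi.single lam (1 : ℝ)} ∪
      {v | ∃ i : Fin m, 1 ≤ (i : ℕ) ∧ (i : ℕ) ≤ a ∧ v = Pi.single i (1 : ℝ)} ∪
      {v | ∃ i j : Fin m, 1 ≤ (i : ℕ) ∧ (i : ℕ) ≤ a ∧ 1 ≤ (j : ℕ) ∧ (j : ℕ) ≤ a ∧
        v = Pi.single i (1 : ℝ) + Pi.single j (1 : ℝ)} ∪
      {v | ∃ l : Fin m, a + 1 ≤ (l : ℕ) ∧ v = Pi.single l (1 : ℝ)} ∪
      {v | ∃ l i : Fin m, a + 1 ≤ (l : ℕ) ∧ 1 ≤ (i : ℕ) ∧ (i : ℕ) ≤ a ∧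
        v = Pi.single l (1 : ℝ) + Pi.single i (1 : ℝ)}) :
    (Nat.factorial m : ℝ≥0∞) * volume (convexHull ℝ S) =
      ((∑ k ∈ Finset.range (m - d), 2 ^ k * Nat.choose (m - k - 2) (d - 1) : ℕ) : ℝ≥0∞) := by
  obtain ⟨e, rfl⟩ : ∃ e, d = e + 1 := ⟨d - 1, by omega⟩
  obtain rfl : m = a + (e + 1) + 1 := by omega
  obtain rfl : lam = 0 := Fin.ext hlam
  have h0 : (0 : Fin (a + (e + 1) + 1) → ℝ) ∈ tSimplexVertices a (e + 1) := Set.mem_insert _ _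
  have hT : ∀ i : Fin (a + (e + 1) + 1), 1 ≤ (i : ℕ) → (i : ℕ) ≤ a →
      Pi.single i (1 : ℝ) ∈ tSimplexVertices a (e + 1) := by
    refine Fin.cases (by simp) fun i _ hi => Or.inr ⟨i, ?_, rfl⟩
    rw [Fin.val_succ] at hi
    omega
  have hhull : convexHull ℝ S = newtonPolytope a (e + 1) := by
    refine (convexHull_min ?_ (convex_newtonPolytope a _)).antisymm
      (newtonPolytope_subset_convexHull ?_ ?_ ?_)
    · have hY : ∀ l : Fin (a + (e + 1) + 1), a + 1 ≤ (l : ℕ) →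
          ∀ v ∈ tSimplexVertices a (e + 1), Pi.single l 1 + v ∈ newtonPolytope a (e + 1) := by
        refine Fin.cases (by simp) fun l hl v hv => single_add_mem_newtonPolytope ?_ hv
        rw [Fin.val_succ] at hl
        omega
      rw [hS]
      rintro v (((((rfl | rfl) | ⟨i, hi, hi', rfl⟩) | ⟨i, j, hi, hi', hj, hj', rfl⟩) |
        ⟨l, hl, rfl⟩) | ⟨l, i, hl, hi, hi', rfl⟩)
      · simpa using add_mem_newtonPolytope_of_mem_tSimplexVertices h0 h0
      · exact single_zero_mem_newtonPolytope a _
      · simpa using add_mem_newtonPolytope_of_mem_tSimplexVertices h0 (hT i hi hi')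
      · exact add_mem_newtonPolytope_of_mem_tSimplexVertices (hT i hi hi') (hT j hj hj')
      · simpa using hY l hl 0 h0
      · exact hY l hl _ (hT i hi hi')
    · simp [hS]
    · rw [hS]
      rintro u (rfl | ⟨i, hi, rfl⟩) v (rfl | ⟨j, hj, rfl⟩)
      · simp
      · rw [zero_add]
        exact .inl <| .inl <| .inl <| .inr ⟨j.succ, by simp, by simpa, rfl⟩
      · rw [add_zero]
        exact .inl <| .inl <| .inl <| .inr ⟨i.succ, by simp, by simpa, rfl⟩
      · exact .inl <| .inl <| .inr ⟨i.succ, j.succ, by simp, by simpa, by simp, by simpa, rfl⟩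
    · rw [hS]
      rintro l hl v (rfl | ⟨j, hj, rfl⟩)
      · rw [add_zero]
        exact .inl <| .inr ⟨l.succ, by simpa, rfl⟩
      · exact .inr ⟨l.succ, j.succ, by simpa, by simp, by simpa, rfl⟩
  rw [hhull, volume_newtonPolytope, ← add_assoc, sum_range_choose_eq_sum_two_pow_mul_choose]
  congr 1
  refine Finset.sum_congr (by congr 1; omega) fun k _ => ?_
  congr 2; omega
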